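/- For every finite family of open real intervals I_j = (l_j, r_j), j = 1,…,n, with l_j < r_j real, there exist natural numbers l'_j < r'_j with r'_j ≤ 2n for all j such that for all distinct p and q, (l_p < r_q and l_q < r_p) if and only if (l'_p < r'_q and l'_q < r'_p); that is, every intersection graph of n open intervals has an interval model with integer endpoints in {0, 1, …, 2n}. -/

import Mathlib

/-- Counting the elements of a finite set below a point reflects and preserves the strict order
when the left point lies in the set. -/
theorem card_filter_lt_lt_iff {α : Type*} [LinearOrder α] {S : Finset α} {x y : α} (hx : x ∈ S) :
    (S.filter (· < x)).card < (S.filter (· < y)).card ↔ x < y := by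
  constructor
  · intro hlt
    by_contra! hyx
    refine hlt.not_ge (Finset.card_le_card fun z hz => ?_)
    rw [Finset.mem_filter] at hz ⊢
    exact ⟨hz.1, hz.2.trans_le hyx⟩
  · intro hxy
    refine Finset.card_lt_card (Finset.ssubset_iff_of_subset (fun z hz => ?_) |>.2 ⟨x, ?_, ?_⟩)
    · rw [Finset.mem_filter] at hz ⊢
      exact ⟨hz.1, hz.2.trans hxy⟩
    · exact Finset.mem_filter.2 ⟨hx, hxy⟩
    · simp

theorem exists_integer_interval_model (n : ℕ) (l r : Fin n → ℝ) (h : ∀ j, l j < r j) :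
    ∃ l' r' : Fin n → ℕ, (∀ j, l' j < r' j) ∧ (∀ j, r' j ≤ 2 * n) ∧
      ∀ p q : Fin n, p ≠ q →
        ((l p < r q ∧ l q < r p) ↔ (l' p < r' q ∧ l' q < r' p)) := by
  let S : Finset ℝ := Finset.univ.image l ∪ Finset.univ.image r
  have hS : S.card ≤ 2 * n := by
    have hl : (Finset.univ.image l).card ≤ n := Finset.card_image_le.trans_eq (by simp)
    have hr : (Finset.univ.image r).card ≤ n := Finset.card_image_le.trans_eq (by simp)
    have hu : S.card ≤ _ := Finset.card_union_le _ _
    omega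
  have hmem (j : Fin n) : l j ∈ S := by simp [S]
  refine ⟨fun j => (S.filter (· < l j)).card, fun j => (S.filter (· < r j)).card,
    fun j => (card_filter_lt_lt_iff (hmem j)).2 (h j),
    fun j => (Finset.card_filter_le _ _).trans hS, fun p q _ => ?_⟩
  exact (and_congr (card_filter_lt_lt_iff (hmem p)) (card_filter_lt_lt_iff (hmem q))).symm
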